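/- Let T be a finite tree with r + 1 vertices whose r edges are labeled e₁, …, e_r and oriented (each edge has a tail and a head). Then there is exactly one labeling v₁, …, v_{r+1} of the vertices of T such that for every 1 ≤ a ≤ r, in the forest obtained from T by deleting the edges e_a, e_{a+1}, …, e_r, every vertex of the connected component containing the tail of e_a has a smaller index than every vertex of the connected component containing the head of e_a. -/

import Mathlib

/-!
Statement 2: let `T` be a finite tree with `r + 1` vertices whose `r` edges are labeled
`e_1, …, e_r` and oriented (each edge `e` has a tail `tail e` and a head `head e`).
Then there is exactly one labeling `v_1, …, v_{r+1}` of the vertices (i.e. one bijection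
`φ : V ≃ Fin (r+1)`) such that for every `1 ≤ a ≤ r`, in the forest obtained by deleting
the edges `e_a, …, e_r`, every vertex of the connected component of the tail of `e_a`
has smaller index than every vertex of the connected component of the head of `e_a`.
-/

/-- The simple graph on the vertex set `V` generated by the oriented edges in `E`;
edge `e` joins `tail e` to `head e`. -/
def treeGraph {r : ℕ} {V : Type*} (tail head : Fin r → V) (E : Finset (Fin r)) :
    SimpleGraph V :=
  SimpleGraph.fromRel (fun x y => ∃ e ∈ E, tail e = x ∧ head e = y)

theorem treeGraph_adj {r : ℕ} {V : Type*} {tail head : Fin r → V} {E : Finset (Fin r)} {x y : V} :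
    (treeGraph tail head E).Adj x y ↔
      x ≠ y ∧ ((∃ e ∈ E, tail e = x ∧ head e = y) ∨ ∃ e ∈ E, tail e = y ∧ head e = x) :=
  SimpleGraph.fromRel_adj _ _ _

theorem treeGraph_mono {r : ℕ} {V : Type*} {tail head : Fin r → V} {E F : Finset (Fin r)}
    (h : E ⊆ F) : treeGraph tail head E ≤ treeGraph tail head F := by
  intro x y hxy
  rw [treeGraph_adj] at hxy ⊢
  exact ⟨hxy.1, hxy.2.imp (fun ⟨e, he, h'⟩ => ⟨e, h he, h'⟩) (fun ⟨e, he, h'⟩ => ⟨e, h he, h'⟩)⟩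

theorem treeGraph_reachable_tail_head {r : ℕ} {V : Type*} {tail head : Fin r → V}
    {E : Finset (Fin r)} {e : Fin r} (he : e ∈ E) :
    (treeGraph tail head E).Reachable (tail e) (head e) := by
  by_cases h : tail e = head e
  · rw [h]
  · exact (treeGraph_adj.2 ⟨h, Or.inl ⟨e, he, rfl, rfl⟩⟩ :
      (treeGraph tail head E).Adj _ _).reachable

theorem treeGraph_empty_reachable {r : ℕ} {V : Type*} {tail head : Fin r → V} {x y : V}
    (h : (treeGraph tail head ∅).Reachable x y) : x = y := by
  obtain ⟨p⟩ := h
  cases p with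
  | nil => rfl
  | cons hadj _ => simp [treeGraph_adj] at hadj

/-- Adding an edge only merges the component of its tail with that of its head. -/
theorem treeGraph_reachable_insert {r : ℕ} {V : Type*} {tail head : Fin r → V}
    {E : Finset (Fin r)} {a : Fin r} {x y : V}
    (h : (treeGraph tail head (insert a E)).Reachable x y) :
    (treeGraph tail head E).Reachable x y ∨
      ((treeGraph tail head E).Reachable (tail a) x ∧
        (treeGraph tail head E).Reachable (head a) y) ∨
      ((treeGraph tail head E).Reachable (tail a) y ∧
        (treeGraph tail head E).Reachable (head a) x) := by
  obtain ⟨p⟩ := h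
  induction p with
  | nil => exact Or.inl (SimpleGraph.Reachable.refl _)
  | @cons u v w hadj _ ih =>
    have step : (treeGraph tail head E).Reachable u v ∨ (tail a = u ∧ head a = v) ∨
        (tail a = v ∧ head a = u) := by
      obtain ⟨-, ⟨e, he, rfl, rfl⟩ | ⟨e, he, rfl, rfl⟩⟩ := treeGraph_adj.1 hadj
      · rcases Finset.mem_insert.1 he with rfl | he
        · exact Or.inr (Or.inl ⟨rfl, rfl⟩)
        · exact Or.inl (treeGraph_reachable_tail_head he)
      · rcases Finset.mem_insert.1 he with rfl | he
        · exact Or.inr (Or.inr ⟨rfl, rfl⟩)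
        · exact Or.inl (treeGraph_reachable_tail_head he).symm
    rcases step with huv | ⟨rfl, rfl⟩ | ⟨rfl, rfl⟩
    · rcases ih with h | ⟨h₁, h₂⟩ | ⟨h₁, h₂⟩
      · exact Or.inl (huv.trans h)
      · exact Or.inr (Or.inl ⟨h₁.trans huv.symm, h₂⟩)
      · exact Or.inr (Or.inr ⟨h₁, h₂.trans huv.symm⟩)
    · rcases ih with h | ⟨-, h⟩ | ⟨h, -⟩
      · exact Or.inr (Or.inl ⟨.refl _, h⟩)
      · exact Or.inr (Or.inl ⟨.refl _, h⟩)
      · exact Or.inl h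
    · rcases ih with h | ⟨-, h⟩ | ⟨h, -⟩
      · exact Or.inr (Or.inr ⟨h, .refl _⟩)
      · exact Or.inl h
      · exact Or.inr (Or.inr ⟨h, .refl _⟩)

/-- The relation which the labeling must respect: for some edge `a`, in the forest of the edges
preceding `a`, the vertex `x` lies in the component of the tail and `y` in that of the head. -/
def TailBeforeHead {r : ℕ} {V : Type*} (tail head : Fin r → V) (x y : V) : Prop :=
  ∃ a : Fin r,
    (treeGraph tail head (Finset.univ.filter (fun e => e < a))).Reachable (tail a) x ∧
    (treeGraph tail head (Finset.univ.filter (fun e => e < a))).Reachable (head a) y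

theorem tailBeforeHead_trichotomous {r : ℕ} {V : Type*} {tail head : Fin r → V}
    (E : Finset (Fin r)) {x y : V} (h : (treeGraph tail head E).Reachable x y) :
    TailBeforeHead tail head x y ∨ x = y ∨ TailBeforeHead tail head y x := by
  induction E using Finset.induction_on_max with
  | empty => exact Or.inr (Or.inl (treeGraph_empty_reachable h))
  | insert a E hE ih =>
    have hle : treeGraph tail head E ≤
        treeGraph tail head (Finset.univ.filter (fun e => e < a)) :=
      treeGraph_mono fun e he => by simpa using hE e he
    rcases treeGraph_reachable_insert h with h | ⟨h₁, h₂⟩ | ⟨h₁, h₂⟩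
    · exact ih h
    · exact Or.inl ⟨a, h₁.mono hle, h₂.mono hle⟩
    · exact Or.inr (Or.inr ⟨a, h₁.mono hle, h₂.mono hle⟩)

/-- In a tree, deleting an edge (and possibly more) disconnects its endpoints. -/
theorem treeGraph_not_reachable_tail_head {r : ℕ} {V : Type*} [DecidableEq V]
    {tail head : Fin r → V} (hloop : ∀ e, tail e ≠ head e)
    (hpar : ∀ e f : Fin r, e ≠ f → ({tail e, head e} : Finset V) ≠ {tail f, head f})
    (hacyc : (treeGraph tail head Finset.univ).IsAcyclic) {E : Finset (Fin r)} {a : Fin r}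
    (ha : a ∉ E) : ¬ (treeGraph tail head E).Reachable (tail a) (head a) := by
  intro h
  have hadj : (treeGraph tail head Finset.univ).Adj (tail a) (head a) :=
    treeGraph_adj.2 ⟨hloop a, Or.inl ⟨a, Finset.mem_univ a, rfl, rfl⟩⟩
  have hbridge := SimpleGraph.isAcyclic_iff_forall_adj_isBridge.1 hacyc hadj
  rw [SimpleGraph.isBridge_iff] at hbridge
  refine hbridge (h.mono fun x y hxy => ?_)
  rw [SimpleGraph.deleteEdges_adj]
  refine ⟨treeGraph_mono (Finset.subset_univ E) hxy, fun hmem => ?_⟩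
  have key : ∀ e ∈ E, s(tail e, head e) ≠ s(tail a, head a) := by
    intro e he heq
    refine hpar e a (fun hea => ha (hea ▸ he)) ?_
    rcases Sym2.eq_iff.1 heq with ⟨h₁, h₂⟩ | ⟨h₁, h₂⟩
    · rw [h₁, h₂]
    · rw [h₁, h₂, Finset.pair_comm]
  obtain ⟨-, ⟨e, he, rfl, rfl⟩ | ⟨e, he, rfl, rfl⟩⟩ := treeGraph_adj.1 hxy
  · exact key e he hmem
  · exact key e he (Sym2.eq_swap.trans hmem)

/-- If no edge joins vertices already connected by its predecessors, then `TailBeforeHead` is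
transitive. -/
theorem TailBeforeHead.trans {r : ℕ} {V : Type*} {tail head : Fin r → V}
    (hsep : ∀ a : Fin r, ¬ (treeGraph tail head
      (Finset.univ.filter (fun e => e < a))).Reachable (tail a) (head a)) {x y z : V}
    (hxy : TailBeforeHead tail head x y) (hyz : TailBeforeHead tail head y z) :
    TailBeforeHead tail head x z := by
  have merge : ∀ {a b : Fin r} {u v : V}, a < b →
      (treeGraph tail head (Finset.univ.filter (fun e => e < a))).Reachable (tail a) u →
      (treeGraph tail head (Finset.univ.filter (fun e => e < a))).Reachable (head a) v →
      (treeGraph tail head (Finset.univ.filter (fun e => e < b))).Reachable u v := by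
    intro a b u v hab hu hv
    have hle : treeGraph tail head (Finset.univ.filter (fun e => e < a)) ≤
        treeGraph tail head (Finset.univ.filter (fun e => e < b)) :=
      treeGraph_mono fun e he => by
        simp only [Finset.mem_filter, Finset.mem_univ, true_and] at he ⊢
        exact he.trans hab
    exact (hu.mono hle).symm.trans
      ((treeGraph_reachable_tail_head (by simpa using hab)).trans (hv.mono hle))
  obtain ⟨a, hax, hay⟩ := hxy
  obtain ⟨b, hby, hbz⟩ := hyz
  rcases lt_trichotomy a b with hab | rfl | hab
  · exact ⟨b, hby.trans (merge hab hax hay).symm, hbz⟩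
  · exact absurd (hby.trans hay.symm) (hsep a)
  · exact ⟨a, hax, hay.trans (merge hab hby hbz)⟩

/-- A strict total order on a type with `n` elements is induced by exactly one bijection
with `Fin n`. -/
theorem existsUnique_equiv_fin_of_isStrictTotalOrder {V : Type*} [Fintype V] {n : ℕ}
    (hcard : Fintype.card V = n) (lt : V → V → Prop) [IsStrictTotalOrder V lt] :
    ∃! φ : V ≃ Fin n, ∀ x y, lt x y → φ x < φ y := by
  classical
  let _ : LinearOrder V := linearOrderOfSTO lt
  have hmono : ∀ φ : V ≃ Fin n, (∀ x y, lt x y → φ x < φ y) → StrictMono φ :=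
    fun φ hφ x y hxy => hφ x y hxy
  refine ⟨(Fintype.orderIsoFinOfCardEq V hcard).symm.toEquiv,
    fun x y hxy => (Fintype.orderIsoFinOfCardEq V hcard).symm.strictMono hxy, fun ψ hψ => ?_⟩
  let ψ' : V ≃o Fin n := (hmono ψ hψ).orderIsoOfSurjective ψ ψ.surjective
  have : ψ' = (Fintype.orderIsoFinOfCardEq V hcard).symm := Subsingleton.elim _ _
  ext x
  exact congrArg (fun f : V ≃o Fin n => (f x : ℕ)) this

theorem unique_vertex_labeling
    {V : Type*} [Fintype V] [DecidableEq V] (r : ℕ)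
    (hcard : Fintype.card V = r + 1)
    (tail head : Fin r → V)
    -- `T` is a tree: no loops, no parallel edges, connected and acyclic
    (hloop : ∀ e, tail e ≠ head e)
    (hpar : ∀ e f : Fin r, e ≠ f → ({tail e, head e} : Finset V) ≠ {tail f, head f})
    (hconn : (treeGraph tail head Finset.univ).Connected)
    (hacyc : (treeGraph tail head Finset.univ).IsAcyclic) :
    ∃! φ : V ≃ Fin (r + 1),
      ∀ (a : Fin r) (x y : V),
        (treeGraph tail head (Finset.univ.filter (fun e => e < a))).Reachable (tail a) x →
        (treeGraph tail head (Finset.univ.filter (fun e => e < a))).Reachable (head a) y →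
        φ x < φ y := by
  have hsep : ∀ a : Fin r, ¬ (treeGraph tail head
      (Finset.univ.filter (fun e => e < a))).Reachable (tail a) (head a) :=
    fun a => treeGraph_not_reachable_tail_head hloop hpar hacyc (by simp)
  have : IsStrictTotalOrder V (TailBeforeHead tail head) :=
    { trichotomous := fun x y hxy hyx =>
        ((tailBeforeHead_trichotomous Finset.univ (hconn.preconnected x y)).resolve_left
          hxy).resolve_right hyx
      irrefl := fun x ⟨a, h₁, h₂⟩ => hsep a (h₁.trans h₂.symm)
      trans := fun _ _ _ => TailBeforeHead.trans hsep }
  obtain ⟨φ, hφ, huniq⟩ :=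
    existsUnique_equiv_fin_of_isStrictTotalOrder hcard (TailBeforeHead tail head)
  exact ⟨φ, fun a x y hx hy => hφ x y ⟨a, hx, hy⟩,
    fun ψ hψ => huniq ψ fun x y ⟨a, hx, hy⟩ => hψ a x y hx hy⟩
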